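/- arXiv:2409.07182 — 2 statements merged into one kernel-verified Lean document; each statement's English description precedes it below -/
import Mathlib

section
/- Let g, Δb, R, H ∈ ℝ with 0 < Δb < g and g > 1, let u, f : ℝ → ℝ be continuous on the interval (−π/2, π/2), and let φ₀ ∈ (−π/2, π/2). Define b(φ) := g − Δb·cos φ and D(φ) := (g − Δb·cos φ)^(−1/2) · ( H·(g − 1)^(1/2) − ∫_{φ₀}^{φ} (g − Δb·cos s)^(−1/2)·( u(s)²·tan s + R·f(s)·u(s) ) ds ). Then D is differentiable on (−π/2, π/2) and for every φ ∈ (−π/2, π/2) the thermal gradient-wind balance holds: u(φ)²·tan φ + R·f(φ)·u(φ) = −( b(φ)·D′(φ) + (D(φ)/2)·b′(φ) ). -/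
open Real

/-- the balanced initial depth of the moist unstable jet test
satisfies the thermal gradient-wind balance on `(-π/2, π/2)`. -/
theorem jet_depth_satisfies_thermal_balance
    (g Δb R H : ℝ) (hΔb : 0 < Δb) (hΔbg : Δb < g) (hg : 1 < g)
    (u f : ℝ → ℝ)
    (hu : ContinuousOn u (Set.Ioo (-(π / 2)) (π / 2)))
    (hf : ContinuousOn f (Set.Ioo (-(π / 2)) (π / 2)))
    (φ₀ : ℝ) (hφ₀ : φ₀ ∈ Set.Ioo (-(π / 2)) (π / 2))
    (b D : ℝ → ℝ)
    (hb : b = fun φ => g - Δb * Real.cos φ)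
    (hD : D = fun φ => (g - Δb * Real.cos φ) ^ (-(1 / 2 : ℝ)) *
      (H * (g - 1) ^ ((1 : ℝ) / 2) -
        ∫ s in φ₀..φ, (g - Δb * Real.cos s) ^ (-(1 / 2 : ℝ)) *
          (u s ^ 2 * Real.tan s + R * f s * u s))) :
    ∀ φ ∈ Set.Ioo (-(π / 2)) (π / 2), DifferentiableAt ℝ D φ ∧
      u φ ^ 2 * Real.tan φ + R * f φ * u φ =
        -(b φ * deriv D φ + (D φ / 2) * deriv b φ) := by
  intro φ hφ
  have hpos : ∀ x : ℝ, 0 < g - Δb * Real.cos x := fun x => by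
    nlinarith [Real.cos_le_one x]
  set G : ℝ → ℝ := fun s => (g - Δb * Real.cos s) ^ (-(1 / 2 : ℝ)) *
          (u s ^ 2 * Real.tan s + R * f s * u s) with hG
  have hGc : ContinuousOn G (Set.Ioo (-(π / 2)) (π / 2)) := by
    have h1 : ContinuousOn (fun s => (g - Δb * Real.cos s) ^ (-(1 / 2 : ℝ)))
        (Set.Ioo (-(π / 2)) (π / 2)) := by
      apply ContinuousOn.rpow_const (by fun_prop)
      intro x _
      exact Or.inl (hpos x).ne'
    exact h1.mul (((hu.pow 2).mul Real.continuousOn_tan_Ioo).add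
      ((continuousOn_const.mul hf).mul hu))
  have hsub : Set.uIcc φ₀ φ ⊆ Set.Ioo (-(π / 2)) (π / 2) :=
    Set.OrdConnected.uIcc_subset Set.ordConnected_Ioo hφ₀ hφ
  have hnhds : Set.Ioo (-(π / 2)) (π / 2) ∈ nhds φ := isOpen_Ioo.mem_nhds hφ
  have hI : HasDerivAt (fun x => ∫ s in φ₀..x, G s) (G φ) φ :=
    intervalIntegral.integral_hasDerivAt_right
      (hGc.mono hsub).intervalIntegrable
      (hGc.stronglyMeasurableAtFilter isOpen_Ioo φ hφ)
      (hGc.continuousAt hnhds)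
  have hb' : HasDerivAt (fun x => g - Δb * Real.cos x) (Δb * Real.sin φ) φ := by
    have h := ((Real.hasDerivAt_cos φ).const_mul Δb).const_sub g
    rwa [mul_neg, neg_neg] at h
  have hr := hb'.rpow_const (p := (-(1 / 2 : ℝ))) (Or.inl (hpos φ).ne')
  have hDd := hr.mul (hI.const_sub (H * (g - 1) ^ ((1 : ℝ) / 2)))
  have hDeq : D = (fun y => (g - Δb * Real.cos y) ^ (-(1 / 2 : ℝ))) *
      fun x => H * (g - 1) ^ ((1 : ℝ) / 2) - ∫ s in φ₀..x, G s := hD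
  have hDd' := hDd
  rw [← hDeq] at hDd'
  refine ⟨hDd'.differentiableAt, ?_⟩
  rw [hDd'.deriv, hb, hb'.deriv, hD]
  have e1 : (g - Δb * Real.cos φ) * (g - Δb * Real.cos φ) ^ (-(1 / 2 : ℝ) - 1)
      = (g - Δb * Real.cos φ) ^ (-(1 / 2 : ℝ)) := by
    rw [Real.rpow_sub_one (hpos φ).ne']
    field_simp [(hpos φ).ne']
  have e2 : (g - Δb * Real.cos φ) * ((g - Δb * Real.cos φ) ^ (-(1 / 2 : ℝ)) *
      (g - Δb * Real.cos φ) ^ (-(1 / 2 : ℝ))) = 1 := by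
    rw [← Real.rpow_add (hpos φ)]
    norm_num
    rw [Real.rpow_neg_one]
    exact mul_inv_cancel₀ (hpos φ).ne'
  have e3 : G φ = (g - Δb * Real.cos φ) ^ (-(1 / 2 : ℝ)) *
          (u φ ^ 2 * Real.tan φ + R * f φ * u φ) := rfl
  rw [e3]
  beta_reduce
  generalize (∫ s in φ₀..φ, G s) = J
  generalize (g - Δb * Real.cos φ) ^ (-(1 / 2 : ℝ) - 1) = q at *
  generalize (g - Δb * Real.cos φ) ^ (-(1 / 2 : ℝ)) = r at *
  generalize g - Δb * Real.cos φ = B at *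
  generalize H * (g - 1) ^ ((1 : ℝ) / 2) = K at *
  generalize u φ ^ 2 * Real.tan φ + R * f φ * u φ = W at *
  linear_combination (-W) * e2 - (Δb * Real.sin φ / 2 * (K - J)) * e1
end

section
/- Let Ω, R, u₀, g be positive reals, set ω := Ω·R·u₀ + u₀²/2 and σ := ω/10, and let Φ₀, θ₀ ∈ ℝ with Φ₀ > ω + σ. Define, for latitude φ ∈ (−π/2, π/2): u(φ) := u₀·cos φ, f(φ) := 2·Ω·sin φ, D(φ) := ( Φ₀ − (ω + σ)·sin²φ ) / g, θ(φ) := ( θ₀ + σ·cos²φ·( (ω + σ)·cos²φ + 2·(Φ₀ − ω − σ) ) ) / ( Φ₀² + (ω + σ)²·sin⁴φ − 2·Φ₀·(ω + σ)·sin²φ ), and b(φ) := g·(1 − θ(φ)). Then D and b are differentiable on (−π/2, π/2) and for every φ ∈ (−π/2, π/2) the steady thermal gradient-wind balance holds: u(φ)²·tan φ + R·f(φ)·u(φ) = −( b(φ)·D′(φ) + (D(φ)/2)·b′(φ) ). -/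
open Real

/-- the initial conditions of the moist steady state geostrophic
flow test satisfy the steady thermal gradient-wind balance on `(-π/2, π/2)`. -/
theorem steady_state_thermal_balance
    (Ω R u₀ g : ℝ) (hΩ : 0 < Ω) (hR : 0 < R) (hu₀ : 0 < u₀) (hg : 0 < g)
    (ω σ Φ₀ θ₀ : ℝ)
    (hω : ω = Ω * R * u₀ + u₀ ^ 2 / 2) (hσ : σ = ω / 10)
    (hΦ₀ : ω + σ < Φ₀)
    (u f D θ b : ℝ → ℝ)
    (hu : u = fun φ => u₀ * Real.cos φ)
    (hf : f = fun φ => 2 * Ω * Real.sin φ)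
    (hD : D = fun φ => (Φ₀ - (ω + σ) * Real.sin φ ^ 2) / g)
    (hθ : θ = fun φ =>
      (θ₀ + σ * Real.cos φ ^ 2 *
          ((ω + σ) * Real.cos φ ^ 2 + 2 * (Φ₀ - ω - σ))) /
        (Φ₀ ^ 2 + (ω + σ) ^ 2 * Real.sin φ ^ 4
          - 2 * Φ₀ * (ω + σ) * Real.sin φ ^ 2))
    (hb : b = fun φ => g * (1 - θ φ)) :
    (∀ φ ∈ Set.Ioo (-(π / 2)) (π / 2),
      DifferentiableAt ℝ D φ ∧ DifferentiableAt ℝ b φ) ∧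
    ∀ φ ∈ Set.Ioo (-(π / 2)) (π / 2),
      u φ ^ 2 * Real.tan φ + R * f φ * u φ =
        -(b φ * deriv D φ + D φ / 2 * deriv b φ) := by
  have hω0 : 0 < ω := by rw [hω]; positivity
  have hσ0 : 0 < σ := by rw [hσ]; positivity
  have hP : ∀ φ : ℝ, 0 < Φ₀ - (ω + σ) * Real.sin φ ^ 2 := by
    intro φ
    nlinarith [Real.sin_sq_le_one φ]
  have hDd : ∀ φ : ℝ, HasDerivAt D (-(2 * (ω + σ) * Real.sin φ * Real.cos φ) / g) φ := by
    intro φ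
    rw [hD]
    have h1 := ((((Real.hasDerivAt_sin φ).pow 2).const_mul (ω + σ)).const_sub Φ₀).div_const g
    refine HasDerivAt.congr_deriv h1 ?_
    push_cast
    ring
  have hb2 : b = fun φ => g * (1 - (θ₀ + σ * Real.cos φ ^ 2 *
          ((ω + σ) * Real.cos φ ^ 2 + 2 * (Φ₀ - ω - σ))) /
        (Φ₀ - (ω + σ) * Real.sin φ ^ 2) ^ 2) := by
    rw [hb, hθ]
    funext φ
    simp only
    congr 3
    ring
  have hN : ∀ φ : ℝ, HasDerivAt (fun φ : ℝ => θ₀ + σ * Real.cos φ ^ 2 *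
          ((ω + σ) * Real.cos φ ^ 2 + 2 * (Φ₀ - ω - σ)))
          (-(4 * σ * Real.cos φ * Real.sin φ * (Φ₀ - (ω + σ) * Real.sin φ ^ 2))) φ := by
    intro φ
    have hc := (Real.hasDerivAt_cos φ).pow 2
    have h1 := ((hc.const_mul σ).mul
      ((hc.const_mul (ω + σ)).add_const (2 * (Φ₀ - ω - σ)))).const_add θ₀
    refine HasDerivAt.congr_deriv h1 ?_
    have := Real.sin_sq φ
    try simp only [Pi.pow_apply]
    rw [this]
    push_cast
    ring
  have hQ : ∀ φ : ℝ, HasDerivAt (fun φ : ℝ => (Φ₀ - (ω + σ) * Real.sin φ ^ 2) ^ 2)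
      (-(4 * (ω + σ) * Real.sin φ * Real.cos φ * (Φ₀ - (ω + σ) * Real.sin φ ^ 2))) φ := by
    intro φ
    have h1 := ((((Real.hasDerivAt_sin φ).pow 2).const_mul (ω + σ)).const_sub Φ₀).pow 2
    refine HasDerivAt.congr_deriv h1 ?_
    try simp only [Pi.pow_apply]
    push_cast
    ring
  have hbd := fun φ : ℝ =>
    (((hN φ).div (hQ φ) (pow_ne_zero 2 (hP φ).ne')).const_sub 1).const_mul g
  have hbd' : ∀ φ, HasDerivAt b _ φ := fun φ => by
    rw [hb2]
    exact hbd φ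
  refine ⟨fun φ _ => ⟨(hDd φ).differentiableAt, (hbd' φ).differentiableAt⟩, fun φ hφ => ?_⟩
  rw [(hDd φ).deriv, (hbd' φ).deriv, hb2, hu, hf, hD, Real.tan_eq_sin_div_cos]
  have hc : Real.cos φ ≠ 0 := (Real.cos_pos_of_mem_Ioo hφ).ne'
  have hL : (u₀ * Real.cos φ) ^ 2 * (Real.sin φ / Real.cos φ)
      + R * (2 * Ω * Real.sin φ) * (u₀ * Real.cos φ) = 2 * ω * Real.sin φ * Real.cos φ := by
    rw [hω]
    field_simp
    ring
  simp only
  rw [hL]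
  have hP' := (hP φ).ne'
  generalize θ₀ + σ * Real.cos φ ^ 2 *
          ((ω + σ) * Real.cos φ ^ 2 + 2 * (Φ₀ - ω - σ)) = N
  generalize Φ₀ - (ω + σ) * Real.sin φ ^ 2 = P at *
  field_simp
  ring
end
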